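/- arXiv:0812.1525 — 5 statements merged into one kernel-verified Lean document; each statement's English description precedes it below -/
import Mathlib

section
/- Let k be a field of characteristic different from 2 and let g ∈ GSp₄(k) satisfy g² = 1 and ν(g) = −1. Then g is conjugate inside GSp₄(k) to the diagonal matrix diag(1,1,−1,−1); that is, there exists h ∈ GSp₄(k) with h⁻¹·g·h = diag(1,1,−1,−1). -/
open Matrix

/-- The standard antidiagonal symplectic matrix `J` defining the form `ψ(x,y) = xᵀJy`. -/
def Jmat (k : Type*) [Field k] : Matrix (Fin 4) (Fin 4) k :=
  !![0, 0, 0, 1;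
     0, 0, 1, 0;
     0, -1, 0, 0;
     -1, 0, 0, 0]

/-- Membership in the symplectic similitude group `GSp₄(k)`:
an invertible matrix `X` with `XᵀJX = ν·J` for some nonzero scalar `ν`. -/
def inGSp4 {k : Type*} [Field k] (g : Matrix (Fin 4) (Fin 4) k) : Prop :=
  IsUnit g.det ∧ ∃ ν : k, ν ≠ 0 ∧ g.transpose * Jmat k * g = ν • Jmat k

theorem aux_basis {k V : Type*} [Field k] [AddCommGroup V] [Module k V]
    (h2 : (2 : k) ≠ 0) (ψ : V →ₗ[k] V →ₗ[k] k) (g : V →ₗ[k] V)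
    (hg : ∀ x, g (g x) = x) (hψg : ∀ x y, ψ (g x) (g y) = - ψ x y)
    (halt : ∀ x y, ψ x y = - ψ y x)
    (hnd : ∀ x, x ≠ 0 → ∃ y, ψ x y = 1)
    (hne : ∃ x : V, x ≠ 0)
    (horth : ∀ x y, ∃ v, v ≠ 0 ∧ ψ x v = 0 ∧ ψ y v = 0) :
    ∃ a b c d, g a = a ∧ g b = b ∧ g c = -c ∧ g d = -d ∧ ψ a d = 1 ∧ ψ b c = 1 ∧
      ψ a c = 0 ∧ ψ b d = 0 := by
  have hg1 : ∀ x y, ψ (g x) y = - ψ x (g y) := fun x y => by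
    have := hψg x (g y); rwa [hg] at this
  -- a subspace-type lemma: from nonzero `v` and a partner `w`, get a nonzero fixed vector
  have key : ∀ v w, ψ v w = 1 → v + g v ≠ 0 ∨ w + g w ≠ 0 := by
    intro v w h
    by_contra hc
    push Not at hc
    obtain ⟨h3, h4⟩ := hc
    have e1 : g v = -v := by rw [eq_neg_iff_add_eq_zero, add_comm]; exact h3
    have e2 : g w = -w := by rw [eq_neg_iff_add_eq_zero, add_comm]; exact h4
    have := hψg v w
    rw [e1, e2] at this
    simp [h] at this
    apply h2
    linear_combination this
  have hfix : ∀ v, g (v + g v) = v + g v := fun v => by rw [map_add, hg, add_comm]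
  -- the negative partner
  have hneg : ∀ y, g ((2 : k)⁻¹ • (y - g y)) = - ((2 : k)⁻¹ • (y - g y)) := fun y => by
    rw [map_smul, map_sub, hg, ← smul_neg, neg_sub]
  have hpair : ∀ a y, g a = a → ψ a ((2 : k)⁻¹ • (y - g y)) = ψ a y := fun a y ha => by
    have := hg1 a y
    rw [ha] at this
    rw [map_smul, map_sub, smul_eq_mul]
    field_simp
    linear_combination -this
  have hself : ∀ x, ψ x x = 0 := fun x => by
    have := halt x x
    have h : 2 * ψ x x = 0 := by linear_combination this
    exact (mul_eq_zero.mp h).resolve_left h2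
  obtain ⟨a, ha0, ha⟩ : ∃ a, a ≠ 0 ∧ g a = a := by
    obtain ⟨v, hv⟩ := hne
    obtain ⟨w, hw⟩ := hnd v hv
    rcases key v w hw with h | h
    · exact ⟨_, h, hfix _⟩
    · exact ⟨_, h, hfix _⟩
  obtain ⟨d, hd, had⟩ : ∃ d, g d = -d ∧ ψ a d = 1 := by
    obtain ⟨y, hy⟩ := hnd a ha0
    exact ⟨_, hneg y, by rw [hpair a y ha, hy]⟩
  have hda : ψ d a = -1 := by rw [halt, had]
  -- partner in the orthogonal complement of `a, d`
  have hnd' : ∀ x, x ≠ 0 → ψ a x = 0 → ψ d x = 0 → ∃ y, ψ x y = 1 ∧ ψ a y = 0 ∧ ψ d y = 0 := by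
    intro x hx h3 h4
    obtain ⟨y, hy⟩ := hnd x hx
    have h5 : ψ x a = 0 := by rw [halt, h3, neg_zero]
    have h6 : ψ x d = 0 := by rw [halt, h4, neg_zero]
    refine ⟨y - ψ a y • d + ψ d y • a, ?_, ?_, ?_⟩ <;>
      simp [hy, h5, h6, hself, had, hda]
  have horthg : ∀ v, ψ a v = 0 → ψ d v = 0 → ψ a (v + g v) = 0 ∧ ψ d (v + g v) = 0 := by
    intro v h3 h4
    have e1 := hg1 a v
    have e2 := hg1 d v
    rw [ha, h3] at e1
    rw [hd, map_neg, LinearMap.neg_apply, h4] at e2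
    rw [map_add, map_add, h3, h4]
    constructor
    · linear_combination e1
    · linear_combination e2
  obtain ⟨b, hb0, hb, hab, hdb⟩ : ∃ b, b ≠ 0 ∧ g b = b ∧ ψ a b = 0 ∧ ψ d b = 0 := by
    obtain ⟨v, hv, hv1, hv2⟩ := horth a d
    obtain ⟨w, hw, hw1, hw2⟩ := hnd' v hv hv1 hv2
    rcases key v w hw with h | h
    · exact ⟨_, h, hfix _, horthg v hv1 hv2⟩
    · exact ⟨_, h, hfix _, horthg w hw1 hw2⟩
  obtain ⟨y, hy, hay, hdy⟩ := hnd' b hb0 hab hdb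
  exact ⟨a, b, _, d, ha, hb, hneg y, hd, had, by rw [hpair b y hb, hy],
    by rw [hpair a y ha, hay], by rw [halt, hdb, neg_zero]⟩

theorem Jmat_sq (k : Type*) [Field k] : Jmat k * Jmat k = -1 := by
  ext i j
  fin_cases i <;> fin_cases j <;> simp [Jmat, Matrix.mul_apply, Fin.sum_univ_four]

/-- If `g ∈ GSp₄(k)`, `char k ≠ 2`, `g² = 1` and `ν(g) = -1`, then `g` is conjugate inside
`GSp₄(k)` to `diag(1,1,-1,-1)`. -/
theorem symplectic_involution_conjugate_to_diag
    {k : Type*} [Field k] (hchar : ringChar k ≠ 2)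
    (g : Matrix (Fin 4) (Fin 4) k)
    (hunit : IsUnit g.det)
    (hsq : g * g = 1)
    (hnu : g.transpose * Jmat k * g = (-1 : k) • Jmat k) :
    ∃ h : Matrix (Fin 4) (Fin 4) k, inGSp4 h ∧
      h⁻¹ * g * h = Matrix.diagonal ![(1 : k), 1, -1, -1] := by
  have h2 : (2 : k) ≠ 0 := Ring.two_ne_zero hchar
  have happ : ∀ x y : Fin 4 → k, Matrix.toLinearMap₂' k (Jmat k) x y = x ⬝ᵥ (Jmat k *ᵥ y) :=
    fun x y => Matrix.toLinearMap₂'_apply' _ _ _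
  have hform : ∀ x y : Fin 4 → k, x ⬝ᵥ (Jmat k *ᵥ y) =
      x 0 * y 3 + x 1 * y 2 - x 2 * y 1 - x 3 * y 0 := fun x y => by
    simp [Jmat, Matrix.mulVec, dotProduct, Fin.sum_univ_four]; ring
  have hgψ : ∀ x y : Fin 4 → k, (g *ᵥ x) ⬝ᵥ (Jmat k *ᵥ (g *ᵥ y)) = - (x ⬝ᵥ (Jmat k *ᵥ y)) := by
    intro x y
    have : (gᵀ * Jmat k * g) *ᵥ y = -(Jmat k *ᵥ y) := by
      rw [hnu, Matrix.smul_mulVec, neg_one_smul]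
    rw [← dotProduct_neg, ← this, ← Matrix.mulVec_mulVec, ← Matrix.mulVec_mulVec,
      Matrix.dotProduct_mulVec x, Matrix.vecMul_transpose]
  obtain ⟨a, b, c, d, ha, hb, hc, hd, had, hbc, hac, hbd⟩ :=
    aux_basis h2 (Matrix.toLinearMap₂' k (Jmat k)) (Matrix.mulVecLin g)
      (fun x => by simp [hsq]) (fun x y => by simp only [happ, Matrix.mulVecLin_apply, hgψ])
      (fun x y => by simp only [happ, hform]; ring)
      (fun x hx => by
        simp only [happ, hform]
        obtain ⟨i, hi⟩ := Function.ne_iff.mp hx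
        have hi : x i ≠ 0 := hi
        fin_cases i
        · exact ⟨Pi.single 3 (x 0)⁻¹, by simp; exact mul_inv_cancel₀ hi⟩
        · exact ⟨Pi.single 2 (x 1)⁻¹, by simp; exact mul_inv_cancel₀ hi⟩
        · exact ⟨Pi.single 1 (-(x 2)⁻¹), by simp; exact mul_inv_cancel₀ hi⟩
        · exact ⟨Pi.single 0 (-(x 3)⁻¹), by simp; exact mul_inv_cancel₀ hi⟩)
      ⟨1, one_ne_zero⟩
      (fun x y => by
        simp only [happ]
        obtain ⟨v, hv, hM⟩ := (Matrix.exists_mulVec_eq_zero_iff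
          (M := Matrix.of ![x ᵥ* Jmat k, y ᵥ* Jmat k, 0, 0])).mpr
          (Matrix.det_eq_zero_of_row_eq_zero 3 (by intro j; simp))
        refine ⟨v, hv, ?_, ?_⟩
        · rw [Matrix.dotProduct_mulVec]; exact congrFun hM 0
        · rw [Matrix.dotProduct_mulVec]; exact congrFun hM 1)
  simp only [happ, Matrix.mulVecLin_apply] at ha hb hc hd had hbc hac hbd
  have hab : a ⬝ᵥ (Jmat k *ᵥ b) = 0 := by
    have := hgψ a b
    rw [ha, hb] at this
    have h : 2 * (a ⬝ᵥ (Jmat k *ᵥ b)) = 0 := by linear_combination this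
    exact (mul_eq_zero.mp h).resolve_left h2
  have hcd : c ⬝ᵥ (Jmat k *ᵥ d) = 0 := by
    have := hgψ c d
    rw [hc, hd, Matrix.mulVec_neg, neg_dotProduct_neg] at this
    have h : 2 * (c ⬝ᵥ (Jmat k *ᵥ d)) = 0 := by linear_combination this
    exact (mul_eq_zero.mp h).resolve_left h2
  let h : Matrix (Fin 4) (Fin 4) k := (Matrix.of ![a, b, c, d])ᵀ
  have hJ : hᵀ * Jmat k * h = Jmat k := by
    rw [hform] at had hbc hac hbd hab hcd
    ext i j
    have hent : (hᵀ * Jmat k * h) i j =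
        (![a, b, c, d] i) ⬝ᵥ (Jmat k *ᵥ (![a, b, c, d] j)) := by
      rw [Matrix.mul_assoc]; rfl
    rw [hent, hform]
    clear hent hform hgψ happ ha hb hc hd hsq hnu hunit
    fin_cases i <;> fin_cases j <;> simp [Jmat] <;> first | ring1 | grind
  have hdet : IsUnit h.det := by
    have hl : (-(Jmat k) * hᵀ * Jmat k) * h = 1 := by
      rw [Matrix.mul_assoc, Matrix.mul_assoc, ← Matrix.mul_assoc hᵀ, hJ, Matrix.neg_mul,
        Jmat_sq, neg_neg]
    exact (Matrix.isUnit_iff_isUnit_det _).mp (IsUnit.of_mul_eq_one_right _ hl)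
  refine ⟨h, ⟨hdet, 1, one_ne_zero, by rw [one_smul]; exact hJ⟩, ?_⟩
  have hgh : g * h = h * Matrix.diagonal ![(1 : k), 1, -1, -1] := by
    ext i j
    rw [Matrix.mul_diagonal]
    fin_cases j
    · have e : (g *ᵥ a) i = _ := congrFun ha i
      refine e.trans ?_
      simp [h]
    · have e : (g *ᵥ b) i = _ := congrFun hb i
      refine e.trans ?_
      simp [h]
    · have e : (g *ᵥ c) i = _ := congrFun hc i
      refine e.trans ?_
      simp [h]
    · have e : (g *ᵥ d) i = _ := congrFun hd i
      refine e.trans ?_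
      simp [h]
  rw [Matrix.mul_assoc, hgh, ← Matrix.mul_assoc, Matrix.nonsing_inv_mul _ hdet, Matrix.one_mul]
end

section
/- Let p be a prime. Let ↑ be the reflexive–transitive closure of the relation on ⋃_{i=0}^{3} C̄ᵢ ∩ X(T) given by λ → rᵢ(λ) whenever λ ∈ C̄ᵢ and i ∈ {0,1,2}, where in the coordinates λ + ρ̃ = (x,y;z) one sets r₀(x,y;z) = (p−y, p−x; z), r₁(x,y;z) = (2p−x, y; z), r₂(x,y;z) = (2p−y, 2p−x; z). Then for all 0 ≤ i ≤ j ≤ 3 and every λ ∈ C̄ᵢ ∩ X(T), there exists a unique weight λ' ∈ C̄ⱼ ∩ X(T) such that λ ↑ λ'. -/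
/-- Membership in the weight lattice `X(T)`: `(a,b;c)` with `c ≡ a + b (mod 2)`. -/
def inXT (v : ℤ × ℤ × ℤ) : Prop := (2 : ℤ) ∣ v.2.2 - v.1 - v.2.1

/-- The shift `λ ↦ λ + ρ̃` with `ρ̃ = (2,1;3)`, giving the coordinates `(x,y;z)`. -/
def sh (v : ℤ × ℤ × ℤ) : ℤ × ℤ × ℤ := (v.1 + 2, v.2.1 + 1, v.2.2 + 3)

/-- λ belongs to the closed alcove `C̄ᵢ` (`i = 0,1,2,3`), in coordinates `(x,y;z) = λ + ρ̃`:
`C̄₀ : x ≥ y ≥ 0, x+y ≤ p`; `C̄₁ : x+y ≥ p, y ≤ x ≤ p`;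
`C̄₂ : x-y ≤ p ≤ x, x+y ≤ 2p`; `C̄₃ : y ≤ p, x+y ≥ 2p, x-y ≤ p`. -/
def Cbar (p : ℕ) (i : ℕ) (l : ℤ × ℤ × ℤ) : Prop :=
  match i with
  | 0 => (sh l).1 ≥ (sh l).2.1 ∧ (sh l).2.1 ≥ 0 ∧ (sh l).1 + (sh l).2.1 ≤ (p : ℤ)
  | 1 => (sh l).1 + (sh l).2.1 ≥ (p : ℤ) ∧ (sh l).2.1 ≤ (sh l).1 ∧ (sh l).1 ≤ (p : ℤ)
  | 2 => (sh l).1 - (sh l).2.1 ≤ (p : ℤ) ∧ (p : ℤ) ≤ (sh l).1 ∧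
      (sh l).1 + (sh l).2.1 ≤ 2 * (p : ℤ)
  | 3 => (sh l).2.1 ≤ (p : ℤ) ∧ (sh l).1 + (sh l).2.1 ≥ 2 * (p : ℤ) ∧
      (sh l).1 - (sh l).2.1 ≤ (p : ℤ)
  | _ => False

/-- The reflection `r₀ : (x,y;z) ↦ (p-y, p-x; z)`, written on the weight `λ` itself. -/
def refl0 (p : ℕ) (l : ℤ × ℤ × ℤ) : ℤ × ℤ × ℤ :=
  ((p : ℤ) - l.2.1 - 3, (p : ℤ) - l.1 - 3, l.2.2)

/-- The reflection `r₁ : (x,y;z) ↦ (2p-x, y; z)`, written on the weight `λ` itself. -/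
def refl1 (p : ℕ) (l : ℤ × ℤ × ℤ) : ℤ × ℤ × ℤ :=
  (2 * (p : ℤ) - l.1 - 4, l.2.1, l.2.2)

/-- The reflection `r₂ : (x,y;z) ↦ (2p-y, 2p-x; z)`, written on the weight `λ` itself. -/
def refl2 (p : ℕ) (l : ℤ × ℤ × ℤ) : ℤ × ℤ × ℤ :=
  (2 * (p : ℤ) - l.2.1 - 3, 2 * (p : ℤ) - l.1 - 3, l.2.2)

/-- One step of the ordering `↑` on `⋃ C̄ᵢ ∩ X(T)`: `λ → rᵢ(λ)` whenever `λ ∈ C̄ᵢ`,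
`i ∈ {0,1,2}`. -/
def UpStep (p : ℕ) (l m : ℤ × ℤ × ℤ) : Prop :=
  inXT l ∧ ((Cbar p 0 l ∧ m = refl0 p l) ∨ (Cbar p 1 l ∧ m = refl1 p l) ∨
    (Cbar p 2 l ∧ m = refl2 p l))

/-- The image in the `k`-th closed alcove of a weight `c` of the lowest closed alcove. -/
def upImage (p k : ℕ) (c : ℤ × ℤ × ℤ) : ℤ × ℤ × ℤ :=
  match k with
  | 0 => c
  | 1 => ((p : ℤ) - c.2.1 - 3, (p : ℤ) - c.1 - 3, c.2.2)
  | 2 => ((p : ℤ) + c.2.1 - 1, (p : ℤ) - c.1 - 3, c.2.2)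
  | _ => ((p : ℤ) + c.1, (p : ℤ) - c.2.1 - 2, c.2.2)

theorem upImage_inXT (p k : ℕ) (c : ℤ × ℤ × ℤ) (hk : k ≤ 3) :
    inXT (upImage p k c) ↔ inXT c := by
  obtain ⟨a, b, z⟩ := c
  interval_cases k <;> simp only [inXT, upImage] <;> omega

theorem upImage_Cbar (p k : ℕ) (c : ℤ × ℤ × ℤ) (hk : k ≤ 3) (hc : Cbar p 0 c) :
    Cbar p k (upImage p k c) := by
  obtain ⟨a, b, z⟩ := c
  interval_cases k <;> simp only [Cbar, sh, upImage] at * <;> omega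

/-- Every weight of the `k`-th closed alcove is the image of one in the lowest alcove. -/
theorem exists_upImage (p k : ℕ) (l : ℤ × ℤ × ℤ) (hk : k ≤ 3) (hl : Cbar p k l) :
    ∃ c, Cbar p 0 c ∧ l = upImage p k c := by
  obtain ⟨a, b, z⟩ := l
  interval_cases k
  · exact ⟨(a, b, z), hl, rfl⟩
  · refine ⟨((p : ℤ) - b - 3, (p : ℤ) - a - 3, z), ?_, ?_⟩ <;>
      simp only [Cbar, sh, upImage, Prod.mk.injEq, and_true, true_and] at * <;> omega
  · refine ⟨((p : ℤ) - b - 3, a - p + 1, z), ?_, ?_⟩ <;>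
      simp only [Cbar, sh, upImage, Prod.mk.injEq, and_true, true_and] at * <;> omega
  · refine ⟨(a - (p : ℤ), (p : ℤ) - b - 2, z), ?_, ?_⟩ <;>
      simp only [Cbar, sh, upImage, Prod.mk.injEq, and_true, true_and] at * <;> omega

/-- The images agree on the overlaps of the closed alcoves. -/
theorem upImage_eq_of_Cbar (p k j : ℕ) (c : ℤ × ℤ × ℤ) (hk : k ≤ 3) (hj : j ≤ 3)
    (hc : Cbar p 0 c) (h : Cbar p j (upImage p k c)) : upImage p k c = upImage p j c := by
  obtain ⟨a, b, z⟩ := c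
  interval_cases k <;> interval_cases j <;>
    simp only [Cbar, sh, upImage, Prod.mk.injEq, and_true, true_and] at * <;> omega

theorem upStep_upImage (p k : ℕ) (c : ℤ × ℤ × ℤ) (hk : k + 1 ≤ 3)
    (hc : Cbar p 0 c) (hx : inXT c) : UpStep p (upImage p k c) (upImage p (k + 1) c) := by
  refine ⟨(upImage_inXT p k c (by omega)).2 hx, ?_⟩
  have h := upImage_Cbar p k c (by omega) hc
  obtain ⟨a, b, z⟩ := c
  have hk2 : k ≤ 2 := by omega
  interval_cases k
  · exact Or.inl ⟨h, rfl⟩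
  · refine Or.inr (Or.inl ⟨h, ?_⟩)
    simp only [upImage, refl1, Prod.mk.injEq, and_true, true_and]; omega
  · refine Or.inr (Or.inr ⟨h, ?_⟩)
    simp only [upImage, refl2, Prod.mk.injEq, and_true, true_and]; omega

theorem eq_of_upStep (p k : ℕ) (c m : ℤ × ℤ × ℤ) (hk : k ≤ 3) (hc : Cbar p 0 c)
    (h : UpStep p (upImage p k c) m) : ∃ k', k' ≤ 3 ∧ m = upImage p k' c := by
  obtain ⟨-, ⟨h, rfl⟩ | ⟨h, rfl⟩ | ⟨h, rfl⟩⟩ := h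
  · rw [upImage_eq_of_Cbar p k 0 c hk (by omega) hc h]
    exact ⟨1, by omega, rfl⟩
  · rw [upImage_eq_of_Cbar p k 1 c hk (by omega) hc h]
    refine ⟨2, by omega, ?_⟩
    simp only [upImage, refl1, Prod.mk.injEq, and_true, true_and]; omega
  · rw [upImage_eq_of_Cbar p k 2 c hk (by omega) hc h]
    refine ⟨3, by omega, ?_⟩
    simp only [upImage, refl2, Prod.mk.injEq, and_true, true_and]; omega

/-- For `0 ≤ i ≤ j ≤ 3` and `λ ∈ C̄ᵢ ∩ X(T)`, there is a unique weight `λ' ∈ C̄ⱼ ∩ X(T)`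
with `λ ↑ λ'`, where `↑` is the reflexive-transitive closure of the reflection steps. -/
theorem exists_unique_up_in_higher_closed_alcove
    (p : ℕ) (hp : p.Prime) (i j : ℕ) (hij : i ≤ j) (hj : j ≤ 3)
    (l : ℤ × ℤ × ℤ) (hl : inXT l) (hli : Cbar p i l) :
    ∃! m : ℤ × ℤ × ℤ, (inXT m ∧ Cbar p j m) ∧ Relation.ReflTransGen (UpStep p) l m := by
  have hi : i ≤ 3 := hij.trans hj
  obtain ⟨c, hc, rfl⟩ := exists_upImage p i l hi hli
  have hx : inXT c := (upImage_inXT p i c hi).1 hl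
  refine ⟨upImage p j c, ⟨⟨(upImage_inXT p j c hj).2 hx, upImage_Cbar p j c hj hc⟩, ?_⟩, ?_⟩
  · clear hli hl
    induction j, hij using Nat.le_induction with
    | base => exact Relation.ReflTransGen.refl
    | succ n hn ih => exact (ih (by omega)).tail (upStep_upImage p n c hj hc hx)
  · rintro m ⟨⟨-, hm⟩, hr⟩
    have key : ∃ k', k' ≤ 3 ∧ m = upImage p k' c := by
      clear hm
      induction hr with
      | refl => exact ⟨i, hi, rfl⟩
      | tail _ hs ih =>
        obtain ⟨k, hk, rfl⟩ := ih
        exact eq_of_upStep p k c _ hk hc hs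
    obtain ⟨k, hk, rfl⟩ := key
    exact upImage_eq_of_Cbar p k j c hk hj hc hm
end

section
/- Let K be an imaginary quadratic number field with ring of integers 𝒪_K and nontrivial automorphism σ (complex conjugation). Let π ∈ 𝒪_K be nonzero such that π/σ(π) is not a root of unity (i.e., π^m ≠ σ(π)^m for all m ≥ 1). Let h ≥ 1 be an integer and q a prime number. Then the absolute norms |N_{K/ℚ}(π^{h·qⁱ} − σ(π)^{h·qⁱ})| are unbounded as i ranges over the natural numbers: for every C there exists i with |N_{K/ℚ}(π^{h·qⁱ} − σ(π)^{h·qⁱ})| > C. -/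
open NumberField

lemma analytic_aux (f z : ℕ → ℂ) (q : ℕ) (hq : 2 ≤ q) (B : ℝ)
    (hB : ∀ i, ‖f i‖ ≤ B) (hf : ∀ i, 1 ≤ ‖f i‖)
    (hz : Filter.Tendsto (fun i => ‖z i‖) Filter.atTop Filter.atTop)
    (hrec : ∀ i, f (i + 1) = (f i + z i) ^ q - z i ^ q) : False := by
  have h1 : Filter.Tendsto (fun i => f i / z i) Filter.atTop (nhds 0) := by
    rw [tendsto_zero_iff_norm_tendsto_zero]
    have h2 : Filter.Tendsto (fun i => B / ‖z i‖) Filter.atTop (nhds 0) :=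
      Filter.Tendsto.const_div_atTop hz B
    refine squeeze_zero (fun i => norm_nonneg _) (fun i => ?_) h2
    rw [norm_div]
    gcongr
    exact hB i
  have h2 : Filter.Tendsto (fun i => ‖∑ j ∈ Finset.range q, (f i / z i + 1) ^ j‖)
      Filter.atTop (nhds (q : ℝ)) := by
    have hc : Continuous (fun t : ℂ => ‖∑ j ∈ Finset.range q, (t + 1) ^ j‖) := by fun_prop
    have := (hc.tendsto 0).comp h1
    simpa [Function.comp_def] using this
  have hq' : (1 : ℝ) < q := by exact_mod_cast hq
  have h3 := h2.eventually (lt_mem_nhds hq')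
  have h4 := hz.eventually_gt_atTop (max B 1)
  obtain ⟨i, hi3, hi4⟩ := (h3.and h4).exists
  have hzB : B < ‖z i‖ := lt_of_le_of_lt (le_max_left _ _) hi4
  have hz1 : 1 < ‖z i‖ := lt_of_le_of_lt (le_max_right _ _) hi4
  have hz0 : z i ≠ 0 := by
    intro h0
    rw [h0, norm_zero] at hz1
    linarith
  have key : f (i + 1) = f i * z i ^ (q - 1) * ∑ j ∈ Finset.range q, (f i / z i + 1) ^ j := by
    have hg := geom_sum_mul (f i / z i + 1) q
    have e1 : f i + z i = z i * (f i / z i + 1) := by field_simp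
    have e2 : f i * z i ^ (q - 1) = (f i / z i) * z i ^ q := by
      obtain ⟨k, rfl⟩ : ∃ k, q = k + 1 := ⟨q - 1, by omega⟩
      rw [Nat.add_sub_cancel, pow_succ]
      field_simp
    rw [hrec, e1, mul_pow, e2]
    rw [add_sub_cancel_right] at hg
    linear_combination (-z i ^ q) * hg
  have h5 := hB (i + 1)
  rw [key, norm_mul, norm_mul, norm_pow] at h5
  have h6 : ‖z i‖ ≤ ‖z i‖ ^ (q - 1) := le_self_pow₀ hz1.le (by omega)
  have h7 : ‖z i‖ ≤ ‖f i‖ * ‖z i‖ ^ (q - 1) := by nlinarith [hf i]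
  nlinarith

lemma one_le_abs_norm {K : Type*} [Field K] [NumberField K] (x : K) (hx : IsIntegral ℤ x)
    (h0 : x ≠ 0) : (1 : ℚ) ≤ |Algebra.norm ℚ x| := by
  have h1 : IsIntegral ℤ (Algebra.norm ℚ x) := Algebra.isIntegral_norm ℚ hx
  obtain ⟨n, hn⟩ := IsIntegrallyClosed.isIntegral_iff.mp h1
  have h2 : Algebra.norm ℚ x ≠ 0 := Algebra.norm_ne_zero_iff.mpr h0
  rw [← hn] at h2 ⊢
  have h3 : n ≠ 0 := by
    rintro rfl
    simp at h2
  have := Int.one_le_abs h3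
  simp only [eq_intCast]
  exact_mod_cast this

/-- Let `K` be an imaginary quadratic field with nontrivial automorphism `σ`, and let
`π ∈ 𝒪_K` be nonzero with `π/σ(π)` not a root of unity (`πᵐ ≠ σ(π)ᵐ` for all `m ≥ 1`).
Then for any `h ≥ 1` and prime `q`, the norms `|N(π^{h·qⁱ} - σ(π)^{h·qⁱ})|` are unbounded. -/
theorem norms_unbounded_imaginary_quadratic
    (K : Type*) [Field K] [NumberField K]
    (hdeg : Module.finrank ℚ K = 2) (hnoreal : IsEmpty (K →+* ℝ))
    (σ : K ≃ₐ[ℚ] K) (hσ : σ ≠ AlgEquiv.refl)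
    (π : 𝓞 K) (hπ : π ≠ 0)
    (hnotroot : ∀ m : ℕ, 1 ≤ m → (π : K) ^ m ≠ σ (π : K) ^ m)
    (h : ℕ) (hh : 1 ≤ h) (q : ℕ) (hq : q.Prime) :
    ∀ C : ℚ, ∃ i : ℕ,
      C < |Algebra.norm ℚ ((π : K) ^ (h * q ^ i) - σ (π : K) ^ (h * q ^ i))| := by
  classical
  intro C
  by_contra! hC
  have hcard : Fintype.card (K →ₐ[ℚ] ℂ) = 2 := by rw [AlgHom.card, hdeg]
  obtain ⟨φ⟩ : Nonempty (K →ₐ[ℚ] ℂ) := by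
    rw [← Fintype.card_pos_iff, hcard]; norm_num
  set ψ : K →ₐ[ℚ] ℂ := φ.comp σ.toAlgHom with hψ
  have hψa : ∀ x, ψ x = φ (σ x) := fun x => rfl
  have hne : φ ≠ ψ := by
    intro he
    apply hσ
    ext x
    have : φ x = φ (σ x) := by rw [← hψa, ← he]
    exact (φ.injective this).symm
  have huniv : (Finset.univ : Finset (K →ₐ[ℚ] ℂ)) = {φ, ψ} := by
    symm
    apply Finset.eq_univ_of_card
    rw [hcard, Finset.card_pair hne]
  have hmem : ∀ τ : K →ₐ[ℚ] ℂ, τ = φ ∨ τ = ψ := by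
    intro τ
    have : τ ∈ (Finset.univ : Finset (K →ₐ[ℚ] ℂ)) := Finset.mem_univ _
    rw [huniv] at this
    simpa using this
  have hconj : ∀ x, (starRingEnd ℂ) (φ x) = ψ x := by
    let τ : K →ₐ[ℚ] ℂ := ((starRingEnd ℂ).comp φ.toRingHom).toRatAlgHom
    have hτ : ∀ x, τ x = (starRingEnd ℂ) (φ x) := fun x => rfl
    rcases hmem τ with h1 | h1
    · exfalso
      have hr : NumberField.ComplexEmbedding.IsReal φ.toRingHom := by
        rw [NumberField.ComplexEmbedding.isReal_iff]
        ext x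
        exact (hτ x).symm.trans (by rw [h1]; rfl)
      exact hnoreal.false hr.embedding
    · intro x
      rw [← hτ, h1]
  have hnormψ : ∀ x, ‖ψ x‖ = ‖φ x‖ := by
    intro x
    rw [← hconj, Complex.norm_conj]
  have hnorm : ∀ x : K, ((|Algebra.norm ℚ x| : ℚ) : ℝ) = ‖φ x‖ ^ 2 := by
    intro x
    have h1 := Algebra.norm_eq_prod_embeddings ℚ ℂ x
    rw [huniv, Finset.prod_pair hne] at h1
    have h2 := congrArg norm h1
    rw [norm_mul, hnormψ] at h2
    rw [sq, ← h2]
    simp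
  have hint : IsIntegral ℤ (π : K) := π.2
  have hint' : IsIntegral ℤ (σ (π : K)) := hint.map (σ.toAlgHom.restrictScalars ℤ)
  have hπ0 : (π : K) ≠ 0 := by simpa using hπ
  have habs : ∀ x : K, IsIntegral ℤ x → x ≠ 0 → 1 ≤ ‖φ x‖ := by
    intro x hx h0
    have h1 : (1 : ℝ) ≤ ((|Algebra.norm ℚ x| : ℚ) : ℝ) := by
      exact_mod_cast one_le_abs_norm x hx h0
    rw [hnorm] at h1
    nlinarith [norm_nonneg (φ x)]
  have hR : 1 < ‖φ (π : K)‖ := by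
    refine lt_of_le_of_ne (habs _ hint hπ0) ?_
    intro he
    obtain ⟨n, hn, hn1⟩ := NumberField.Embeddings.pow_eq_one_of_norm_eq_one K ℂ hint (by
      intro τ
      have : τ (π : K) = τ.toRatAlgHom (π : K) := rfl
      rw [this]
      rcases hmem τ.toRatAlgHom with h1 | h1
      · rw [h1, ← he]
      · rw [h1, hnormψ, ← he])
    apply hnotroot n hn
    rw [← map_pow σ, hn1, map_one]
  have hqpos : ∀ i, 1 ≤ h * q ^ i := fun i => Nat.mul_pos hh (pow_pos hq.pos i)
  refine analytic_aux (fun i => φ ((π : K) ^ (h * q ^ i) - σ (π : K) ^ (h * q ^ i)))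
    (fun i => φ (σ (π : K) ^ (h * q ^ i))) q hq.two_le (max (C : ℝ) 1) ?_ ?_ ?_ ?_
  · intro i
    have h1 : ((|Algebra.norm ℚ ((π : K) ^ (h * q ^ i) - σ (π : K) ^ (h * q ^ i))| : ℚ) : ℝ)
        ≤ (C : ℝ) := by exact_mod_cast hC i
    rw [hnorm] at h1
    by_contra! hlt
    have h2 := lt_of_le_of_lt (le_max_left _ _) hlt
    have h3 := lt_of_le_of_lt (le_max_right _ _) hlt
    nlinarith
  · intro i
    exact habs _ ((hint.pow _).sub (hint'.pow _)) (sub_ne_zero.mpr (hnotroot _ (hqpos i)))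
  · have h1 : ∀ i, ‖φ (σ (π : K) ^ (h * q ^ i))‖ = ‖φ (π : K)‖ ^ (h * q ^ i) := by
      intro i
      rw [map_pow, norm_pow, ← hψa, hnormψ]
    simp only [h1]
    refine (tendsto_pow_atTop_atTop_of_one_lt hR).comp ?_
    refine Filter.tendsto_atTop_mono (fun i => ?_) (tendsto_pow_atTop_atTop_of_one_lt hq.one_lt)
    exact Nat.le_mul_of_pos_left _ hh
  · intro i
    simp only [← map_add, ← map_pow, ← map_sub]
    congr 1
    rw [sub_add_cancel, pow_succ, ← mul_assoc, pow_mul, pow_mul]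
    simp only [map_pow]
end

section
/- Let K be an imaginary quadratic number field with ring of integers 𝒪_K and nontrivial automorphism σ, and let p be a prime number that splits in K. Let 𝔭 be a prime ideal of 𝒪_K above p, let h ≥ 1, and suppose 𝔭^h = π𝒪_K is principal with generator π. Then for every n ≥ 1 with π^n ≠ σ(π)^n, the ideal (π^n − σ(π)^n)𝒪_K is coprime to p, i.e., the absolute norm of this ideal is not divisible by p. -/
open NumberField

/-- Let `K` be an imaginary quadratic field with nontrivial automorphism `σ` (acting on the
ring of integers), and let `p` be a prime split in `K`, say `p𝒪_K = 𝔭·σ(𝔭)` with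
`𝔭 ≠ σ(𝔭)` prime. If `𝔭ʰ = π𝒪_K` is principal then for every `n ≥ 1` with `πⁿ ≠ σ(π)ⁿ`,
the ideal `(πⁿ - σ(π)ⁿ)𝒪_K` is coprime to `p`: its absolute norm is not divisible by `p`. -/
theorem ideal_coprime_to_p
    (K : Type*) [Field K] [NumberField K]
    (hdeg : Module.finrank ℚ K = 2) (hnoreal : IsEmpty (K →+* ℝ))
    (σ : 𝓞 K ≃+* 𝓞 K) (hσ : σ ≠ RingEquiv.refl (𝓞 K))
    (p : ℕ) (hp : p.Prime)
    (P : Ideal (𝓞 K)) (hP : P.IsPrime)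
    (hsplit : Ideal.span {(p : 𝓞 K)} = P * Ideal.map (σ : 𝓞 K →+* 𝓞 K) P)
    (hPne : P ≠ Ideal.map (σ : 𝓞 K →+* 𝓞 K) P)
    (h : ℕ) (hh : 1 ≤ h)
    (π : 𝓞 K) (hπ : P ^ h = Ideal.span {π})
    (n : ℕ) (hn : 1 ≤ n) (hne : π ^ n ≠ σ π ^ n) :
    ¬ (p ∣ Ideal.absNorm (Ideal.span {π ^ n - σ π ^ n} : Ideal (𝓞 K))) := by
  intro hdvd
  set I : Ideal (𝓞 K) := Ideal.span {π ^ n - σ π ^ n} with hI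
  set Q : Ideal (𝓞 K) := Ideal.map (σ : 𝓞 K →+* 𝓞 K) P with hQ
  have hp0 : (p : 𝓞 K) ≠ 0 := by exact_mod_cast hp.ne_zero
  have hPQ0 : P * Q ≠ ⊥ := by
    rw [← hsplit]
    simpa [Ideal.span_singleton_eq_bot] using hp.ne_zero
  have hP0 : P ≠ ⊥ := by
    rintro h0
    apply hPQ0
    rw [h0, Ideal.bot_mul]
  have hQ0 : Q ≠ ⊥ := by
    rintro h0
    apply hPQ0
    rw [h0, Ideal.mul_bot]
  have hQprime : Q.IsPrime := Ideal.map_isPrime_of_equiv σ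
  have hPmax : P.IsMaximal := hP.isMaximal hP0
  have hQmax : Q.IsMaximal := hQprime.isMaximal hQ0
  have hQh : Q ^ h = Ideal.span {σ π} := by
    rw [hQ, ← Ideal.map_pow, hπ, Ideal.map_span]
    simp
  have hI0 : I ≠ ⊥ := by
    rw [hI, Ne, Ideal.span_singleton_eq_bot, sub_eq_zero]
    exact hne
  have hIp : I ⊔ Ideal.span {(p : 𝓞 K)} ≠ ⊤ := by
    intro htop
    have hfin : Finite (𝓞 K ⧸ I) := Ideal.finiteQuotientOfFreeOfNeBot I hI0
    haveI : Fact p.Prime := ⟨hp⟩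
    have hcard : p ∣ Nat.card (𝓞 K ⧸ I) := by
      simpa [Ideal.absNorm_apply, Submodule.cardQuot_apply] using hdvd
    obtain ⟨x, hx⟩ := exists_prime_addOrderOf_dvd_card' p hcard
    have hpx : (p : 𝓞 K ⧸ I) * x = 0 := by
      rw [← nsmul_eq_mul, ← hx]
      exact addOrderOf_nsmul_eq_zero x
    have h1 : (1 : 𝓞 K) ∈ I ⊔ Ideal.span {(p : 𝓞 K)} := by rw [htop]; trivial
    obtain ⟨i, hi, y, hy, hiy⟩ := Submodule.mem_sup.1 h1
    obtain ⟨a, rfl⟩ := Ideal.mem_span_singleton'.1 hy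
    have h2 := congrArg (Ideal.Quotient.mk I) hiy
    rw [map_add, Ideal.Quotient.eq_zero_iff_mem.2 hi, zero_add, map_mul, map_one,
      map_natCast] at h2
    have hx0 : x = 0 := by
      rw [← one_mul x, ← h2, mul_assoc, hpx, mul_zero]
    rw [hx0, addOrderOf_zero] at hx
    exact hp.one_lt.ne hx
  obtain ⟨M, hM, hle⟩ := Ideal.exists_le_maximal _ hIp
  have hMp : M.IsPrime := hM.isPrime
  have hd : π ^ n - σ π ^ n ∈ M :=
    hle (Ideal.mem_sup_left (Ideal.mem_span_singleton_self _))
  have hn0 : n ≠ 0 := by omega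
  have hh0 : h ≠ 0 := by omega
  have hPM : P ≤ M ↔ π ∈ M := by
    rw [← Ideal.span_singleton_le_iff_mem, ← hπ, hMp.pow_le_iff hh0]
  have hQM : Q ≤ M ↔ σ π ∈ M := by
    rw [← Ideal.span_singleton_le_iff_mem, ← hQh, hMp.pow_le_iff hh0]
  have hiff : π ∈ M ↔ σ π ∈ M := by
    rw [← hMp.pow_mem_iff_mem n (by omega), ← hMp.pow_mem_iff_mem (r := σ π) n (by omega)]
    exact ⟨fun hm => by simpa using M.sub_mem hm hd, fun hm => by simpa using M.add_mem hd hm⟩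
  have hmul : P * Q ≤ M := by
    rw [← hsplit]
    exact le_sup_right.trans hle
  have hboth : P ≤ M ∧ Q ≤ M := by
    rcases hMp.mul_le.1 hmul with h1 | h1
    · exact ⟨h1, hQM.2 (hiff.1 (hPM.1 h1))⟩
    · exact ⟨hPM.2 (hiff.2 (hQM.1 h1)), h1⟩
  exact hPne ((hPmax.eq_of_le hM.ne_top hboth.1).trans
    (hQmax.eq_of_le hM.ne_top hboth.2).symm)
end

section
/- Let p be a prime number, m ≥ 1 an integer, and ζ ∈ ℂˣ a root of unity with ζ^m = 1. Then there exist an integer N ≥ 1 coprime to p and a Dirichlet character χ modulo N (a multiplicative character χ : (ℤ/Nℤ)ˣ → ℂˣ) such that χ(p mod N) = ζ. In other words, there exist Dirichlet characters of conductor prime to p taking any prescribed finite-order value at p. -/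
/-- For every prime `p` and every root of unity `ζ` (say `ζᵐ = 1`, `m ≥ 1`), there is a
Dirichlet character of modulus `N` coprime to `p` taking the value `ζ` at `p`. -/
theorem exists_dirichlet_character_prescribed_value_at_p
    (p : ℕ) (hp : p.Prime) (m : ℕ) (hm : 1 ≤ m) (ζ : ℂ) (hζ : ζ ^ m = 1) :
    ∃ N : ℕ, 1 ≤ N ∧ Nat.Coprime N p ∧
      ∃ χ : DirichletCharacter ℂ N, χ (p : ZMod N) = ζ := by
  have h1 : 1 < p ^ m := Nat.one_lt_pow (by omega) hp.one_lt
  have hcop : Nat.Coprime (p ^ m - 1) p := by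
    have h : Nat.Coprime (p ^ m - 1) (p ^ m) := by
      have := Nat.coprime_self_add_right (m := p ^ m - 1) (n := 1)
      rw [Nat.sub_add_cancel h1.le] at this
      exact this.2 (Nat.coprime_one_right _)
    exact Nat.Coprime.coprime_dvd_right (dvd_pow_self p (by omega)) h
  refine ⟨p ^ m - 1, by omega, hcop, ?_⟩
  generalize hN : p ^ m - 1 = N at *
  have : NeZero N := ⟨by omega⟩
  let u : (ZMod N)ˣ := ZMod.unitOfCoprime p hcop.symm
  let z : ℂˣ := Units.mk0 ζ (by rintro rfl; simp [zero_pow (show m ≠ 0 by omega)] at hζ)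
  have hz : orderOf z ∣ m := orderOf_dvd_of_pow_eq_one (by ext; simp [z, hζ])
  have hu : m ∣ orderOf u := by
    have h : u ^ orderOf u = 1 := pow_orderOf_eq_one u
    generalize orderOf u = k at h
    have h2 : ((p ^ k : ℕ) : ZMod N) = ((1 : ℕ) : ZMod N) := by
      have := congrArg Units.val h
      simpa [u] using this
    have h3 : N ∣ p ^ k - 1 :=
      (Nat.modEq_iff_dvd' (Nat.one_le_pow _ _ hp.pos)).1
        ((ZMod.natCast_eq_natCast_iff _ _ _).1 h2).symm
    have h4 := Nat.pow_sub_one_gcd_pow_sub_one p m k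
    rw [hN, Nat.gcd_eq_left h3] at h4
    have h5 : 1 ≤ p ^ Nat.gcd m k := Nat.one_le_pow _ _ hp.pos
    have h6 : p ^ m = p ^ Nat.gcd m k := by omega
    have h7 := Nat.pow_right_injective hp.two_le h6
    rw [h7]
    exact Nat.gcd_dvd_right _ _
  let g : Subgroup.zpowers u := ⟨u, Subgroup.mem_zpowers u⟩
  have hg : ∀ x, x ∈ Subgroup.zpowers g := by
    rintro ⟨x, n, rfl⟩
    exact ⟨n, by ext; simp [g]⟩
  have hgz : orderOf z ∣ orderOf g := by
    rw [← Subgroup.orderOf_coe]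
    exact hz.trans hu
  have : NeZero ((Monoid.exponent (ZMod N)ˣ : ℕ) : ℂ) :=
    ⟨by exact_mod_cast Monoid.exponent_ne_zero_of_finite⟩
  obtain ⟨φ, hφ⟩ := MonoidHom.domRestrict_surjective (M := ℂ) (Subgroup.zpowers u)
    (monoidHomOfForallMemZpowers hg hgz)
  refine ⟨MulChar.ofUnitHom φ, ?_⟩
  have e : φ u = z := by
    have := DFunLike.congr_fun hφ g
    rw [monoidHomOfForallMemZpowers_apply_gen] at this
    exact this
  have h8 : ((p : ℕ) : ZMod N) = (u : ZMod N) := by simp [u]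
  rw [h8, MulChar.ofUnitHom_coe, e]
  simp [z]
end
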